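/- Let F_1, …, F_10 ⊆ {1, …, 8} be the sets F_1 = {1,2,3,4,5}, F_2 = {1,2,3,4,6}, F_3 = {1,2,5,7,8}, F_4 = {1,2,6,7,8}, F_5 = {1,4,5,6,8}, F_6 = {3,4,5,7,8}, F_7 = {2,3,5,7}, F_8 = {2,3,6,7}, F_9 = {3,4,6,7}, F_10 = {4,6,7,8}. Then every matrix S ∈ ℂ^{8×10} satisfying S_{ij} = 0 if i ∈ F_j and S_{ij} ≠ 0 if i ∉ F_j has rank(S) ≥ 6. (Hence there is no rank-5 matrix with this support; in particular, no 4-polytope, and not even a point–hyperplane arrangement in ℝ^4 or ℂ^4, has vertex–facet incidence structure given by the F_j.) -/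

import Mathlib

open Matrix

/-- The vertex sets of the facets of the first non-polytopal 3-sphere with 8
vertices from Altshuler–Steinberg's enumeration (0-indexed). -/
def F16 : Fin 10 → Finset (Fin 8) :=
  ![{0,1,2,3,4}, {0,1,2,3,5}, {0,1,4,6,7}, {0,1,5,6,7}, {0,3,4,5,7},
    {2,3,4,6,7}, {1,2,4,6}, {1,2,5,6}, {2,3,5,6}, {3,5,6,7}]

/-- If the rank of `S` is at least three below its number of rows, its left kernel contains a
nonzero vector vanishing at two prescribed coordinates. -/
theorem exists_left_kernel_vanishing {K m n : Type*} [Field K] [Fintype m] [Fintype n]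
    (S : Matrix m n K) (hS : S.rank + 2 < Fintype.card m) (a b : m) :
    ∃ v : m → K, v ≠ 0 ∧ v ᵥ* S = 0 ∧ v a = 0 ∧ v b = 0 := by
  classical
  have hker : 2 < Module.finrank K (LinearMap.ker Sᵀ.mulVecLin) := by
    have hsum := Sᵀ.mulVecLin.finrank_range_add_finrank_ker
    have hrank : Module.finrank K (LinearMap.range Sᵀ.mulVecLin) = S.rank := S.rank_transpose
    rw [Module.finrank_fintype_fun_eq_card] at hsum
    omega
  let f : LinearMap.ker Sᵀ.mulVecLin →ₗ[K] K × K :=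
    ((LinearMap.proj a).prod (LinearMap.proj b)) ∘ₗ Submodule.subtype _
  have hf : LinearMap.ker f ≠ ⊥ := LinearMap.ker_ne_bot_of_finrank_lt (by simpa using hker)
  obtain ⟨⟨v, hv⟩, hvf, hv0⟩ := Submodule.exists_mem_ne_zero_of_ne_bot hf
  have hab : v a = 0 ∧ v b = 0 := by simpa [f] using hvf
  exact ⟨v, by simpa using hv0, by simpa [mulVec_transpose] using hv, hab⟩

/-- every complex `8 × 10` matrix whose `(i, j)` entry vanishes
exactly when vertex `i` lies in facet `F_j` has rank at least 6; in particular
there is no rank-5 matrix with this support. -/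
theorem statement_16 (S : Matrix (Fin 8) (Fin 10) ℂ)
    (h : ∀ i j, S i j = 0 ↔ i ∈ F16 j) : 6 ≤ S.rank := by
  by_contra hlt
  have zero (i j) (hij : i ∈ F16 j) : S i j = 0 := (h i j).2 hij
  have ne (i j) (hij : i ∉ F16 j) : S i j ≠ 0 := fun h0 => hij ((h i j).1 h0)
  have hS : S.rank + 2 < Fintype.card (Fin 8) := by
    rw [Fintype.card_fin]
    omega
  have relations (v : Fin 8 → ℂ) (hv : v ᵥ* S = 0) :
      v 5 * S 5 0 + v 6 * S 6 0 + v 7 * S 7 0 = 0 ∧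
      v 4 * S 4 1 + v 6 * S 6 1 + v 7 * S 7 1 = 0 ∧
      v 2 * S 2 2 + v 3 * S 3 2 + v 5 * S 5 2 = 0 ∧
      v 2 * S 2 3 + v 3 * S 3 3 + v 4 * S 4 3 = 0 ∧
      v 1 * S 1 4 + v 2 * S 2 4 + v 6 * S 6 4 = 0 ∧
      v 0 * S 0 5 + v 1 * S 1 5 + v 5 * S 5 5 = 0 ∧
      v 0 * S 0 8 + v 1 * S 1 8 + v 4 * S 4 8 + v 7 * S 7 8 = 0 := by
    have column (j) : ∑ i ∈ (F16 j)ᶜ, v i * S i j = 0 := by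
      refine (Finset.sum_subset (Finset.subset_univ _) fun i _ hi => ?_).trans (congrFun hv j)
      rw [zero i j (by simpa using hi), mul_zero]
    have c0 : (F16 0)ᶜ = {5, 6, 7} := by decide
    have c1 : (F16 1)ᶜ = {4, 6, 7} := by decide
    have c2 : (F16 2)ᶜ = {2, 3, 5} := by decide
    have c3 : (F16 3)ᶜ = {2, 3, 4} := by decide
    have c4 : (F16 4)ᶜ = {1, 2, 6} := by decide
    have c5 : (F16 5)ᶜ = {0, 1, 5} := by decide
    have c8 : (F16 8)ᶜ = {0, 1, 4, 7} := by decide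
    have h0 := column 0
    have h1 := column 1
    have h2 := column 2
    have h3 := column 3
    have h4 := column 4
    have h5 := column 5
    have h8 := column 8
    rw [c0] at h0
    rw [c1] at h1
    rw [c2] at h2
    rw [c3] at h3
    rw [c4] at h4
    rw [c5] at h5
    rw [c8] at h8
    simp [← add_assoc] at h0 h1 h2 h3 h4 h5 h8
    exact ⟨h0, h1, h2, h3, h4, h5, h8⟩
  have n70 := ne 7 0 (by decide)
  have n60 := ne 6 0 (by decide)
  have n41 := ne 4 1 (by decide)
  have n32 := ne 3 2 (by decide)
  have n43 := ne 4 3 (by decide)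
  have n14 := ne 1 4 (by decide)
  have n24 := ne 2 4 (by decide)
  have n05 := ne 0 5 (by decide)
  have n78 := ne 7 8 (by decide)
  have hdet : S 1 8 * S 0 5 - S 0 8 * S 1 5 = 0 := by
    obtain ⟨v, hv, hvS, v5, v6⟩ := exists_left_kernel_vanishing S hS 5 6
    obtain ⟨h0, h1, h2, -, h4, h5, h8⟩ := relations v hvS
    have v7 : v 7 = 0 := by simpa [v5, v6, n70] using h0
    have v4 : v 4 = 0 := by simpa [v6, v7, n41] using h1
    have v1 : v 1 ≠ 0 := by
      intro v1
      have v2 : v 2 = 0 := by simpa [v1, v6, n24] using h4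
      have v3 : v 3 = 0 := by simpa [v2, v5, n32] using h2
      have v0 : v 0 = 0 := by simpa [v1, v5, n05] using h5
      exact hv (by ext i; fin_cases i <;> assumption)
    simp only [v4, v5, v7, zero_mul, add_zero] at h5 h8
    refine (mul_eq_zero.1 ?_).resolve_left v1
    linear_combination S 0 5 * h8 - S 0 8 * h5
  obtain ⟨w, hw, hwS, w5, w2⟩ := exists_left_kernel_vanishing S hS 5 2
  obtain ⟨h0, -, h2, h3, h4, h5, h8⟩ := relations w hwS
  have w3 : w 3 = 0 := by simpa [w2, w5, n32] using h2
  have w4 : w 4 = 0 := by simpa [w2, w3, n43] using h3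
  simp only [w4, w5, zero_mul, add_zero] at h5 h8
  have w7 : w 7 = 0 := by
    refine (mul_eq_zero.1 ?_).resolve_right (mul_ne_zero n78 n05)
    linear_combination S 0 5 * h8 - S 0 8 * h5 - w 1 * hdet
  have w6 : w 6 = 0 := by simpa [w5, w7, n60] using h0
  have w1 : w 1 = 0 := by simpa [w2, w6, n14] using h4
  have w0 : w 0 = 0 := by simpa [w1, n05] using h5
  exact hw (by ext i; fin_cases i <;> assumption)
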